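/- arXiv:2401.16431 — 4 statements merged into one kernel-verified Lean document; each statement's English description precedes it below -/
import Mathlib

section
/- Every limit point of the sequence of monomial-barrier minimizers solves the box-constrained problem: if ẑ is the limit of a subsequence of (z^k), then ẑ ∈ Ω and f(ẑ) = f(z*), i.e. ẑ is a global minimizer of f over Ω. (Theorem 1 of the paper.) -/
open Filter Topology

/-- The scaled monomial penalty is at most `1 / n` on the unit box. -/
lemma monomial_penalty_le_of_mem_box {m n : ℕ} (hm : 1 ≤ m) {z : Fin m → ℝ}
    (hz : ∀ i, -1 ≤ z i ∧ z i ≤ 1) :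
    (1 / ((m : ℝ) * (n : ℝ))) * ∑ i, (z i) ^ n ≤ 1 / (n : ℝ) := by
  have hm' : (m : ℝ) ≠ 0 := by positivity
  have hsum : ∑ i, (z i) ^ n ≤ (m : ℝ) := by
    calc ∑ i, (z i) ^ n ≤ ∑ _i : Fin m, (1 : ℝ) := by
          refine Finset.sum_le_sum fun i _ => ?_
          refine (le_abs_self _).trans ?_
          rw [abs_pow]
          exact pow_le_one₀ (abs_nonneg _) (abs_le.mpr (hz i))
      _ = m := by simp
  calc (1 / ((m : ℝ) * (n : ℝ))) * ∑ i, (z i) ^ n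
      ≤ (1 / ((m : ℝ) * (n : ℝ))) * m := by gcongr
    _ = 1 / (n : ℝ) := by
      rw [one_div, mul_inv, mul_right_comm, inv_mul_cancel₀ hm', one_mul, one_div]

/-- Theorem 1 (Convergence) of the paper: every limit point of the sequence of
monomial-barrier minimizers is feasible and is a global minimizer of `f` over the
unit box `Ω`. -/
theorem monomial_barrier_limit_point_solves
    (m : ℕ) (hm : 1 ≤ m) (f : (Fin m → ℝ) → ℝ)
    (hconv : ConvexOn ℝ Set.univ f) (hcont : Continuous f)
    (Ω : Set (Fin m → ℝ)) (hΩ : Ω = {z | ∀ i, -1 ≤ z i ∧ z i ≤ 1})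
    (zstar : Fin m → ℝ) (hzstar_mem : zstar ∈ Ω)
    (hzstar_min : ∀ z ∈ Ω, f zstar ≤ f z)
    (P : ℕ → (Fin m → ℝ) → ℝ)
    (hP : ∀ (μ : ℕ) (z : Fin m → ℝ),
      P μ z = f z + (1 / ((m : ℝ) * (μ : ℝ))) * ∑ i, (z i) ^ μ)
    (μk : ℕ → ℕ) (hμ_even : ∀ k, Even (μk k)) (hμ_pos : ∀ k, 0 < μk k)
    (hμ_tendsto : Filter.Tendsto μk Filter.atTop Filter.atTop)
    (zk : ℕ → (Fin m → ℝ))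
    (hzk_min : ∀ k, ∀ z : Fin m → ℝ, P (μk k) (zk k) ≤ P (μk k) z)
    (zhat : Fin m → ℝ) (φ : ℕ → ℕ) (hφ : StrictMono φ)
    (hlim : Filter.Tendsto (fun k => zk (φ k)) Filter.atTop (nhds zhat)) :
    zhat ∈ Ω ∧ f zhat = f zstar := by
  subst hΩ
  have hn : Tendsto (fun k => μk (φ k)) atTop atTop := hμ_tendsto.comp hφ.tendsto_atTop
  have hinv : Tendsto (fun k => 1 / (μk (φ k) : ℝ)) atTop (𝓝 0) :=
    tendsto_one_div_atTop_nhds_zero_nat.comp hn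
  have hf : Tendsto (fun k => f (zk (φ k))) atTop (𝓝 (f zhat)) :=
    (hcont.tendsto zhat).comp hlim
  have hgap : Tendsto (fun k => f zstar + 1 / (μk (φ k) : ℝ) - f (zk (φ k))) atTop
      (𝓝 (f zstar + 0 - f zhat)) := (hinv.const_add _).sub hf
  have hpen : ∀ k, (1 / ((m : ℝ) * (μk (φ k) : ℝ))) * ∑ i, (zk (φ k) i) ^ μk (φ k)
      ≤ f zstar + 1 / (μk (φ k) : ℝ) - f (zk (φ k)) := by
    intro k
    have h := hzk_min (φ k) zstar
    rw [hP, hP] at h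
    have h' := monomial_penalty_le_of_mem_box (n := μk (φ k)) hm hzstar_mem
    linarith
  have hmem : ∀ i, |zhat i| ≤ 1 := by
    intro i
    by_contra! hi
    obtain ⟨r, hr1, hr⟩ := exists_between hi
    have hcoord : Tendsto (fun k => |zk (φ k) i|) atTop (𝓝 |zhat i|) :=
      ((tendsto_pi_nhds.mp hlim) i).abs
    have hratio : Tendsto (fun k => (μk (φ k) : ℝ) / r ^ μk (φ k)) atTop (𝓝 0) := by
      have h := tendsto_pow_const_div_const_pow_of_one_lt 1 hr1
      simp only [pow_one] at h
      exact h.comp hn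
    have hzero := (hratio.const_mul (m : ℝ)).mul hgap
    rw [mul_zero, zero_mul] at hzero
    have hone : (1 : ℝ) ≤ 0 := by
      refine ge_of_tendsto hzero ?_
      filter_upwards [hcoord.eventually_const_lt hr] with k hk
      have hpos : (0 : ℝ) < μk (φ k) := by exact_mod_cast hμ_pos (φ k)
      have hmpos : (0 : ℝ) < m := by exact_mod_cast hm
      have hrpos : 0 < r ^ μk (φ k) := by positivity
      have hpow : r ^ μk (φ k) ≤ ∑ j, (zk (φ k) j) ^ μk (φ k) := by
        calc r ^ μk (φ k) ≤ |zk (φ k) i| ^ μk (φ k) := by gcongr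
          _ = (zk (φ k) i) ^ μk (φ k) := (hμ_even (φ k)).pow_abs _
          _ ≤ ∑ j, (zk (φ k) j) ^ μk (φ k) :=
            Finset.single_le_sum (f := fun j => (zk (φ k) j) ^ μk (φ k))
              (fun j _ => (hμ_even (φ k)).pow_nonneg _) (Finset.mem_univ i)
      calc (1 : ℝ) = (m * (μk (φ k) / r ^ μk (φ k))) *
            ((1 / ((m : ℝ) * (μk (φ k) : ℝ))) * r ^ μk (φ k)) := by field_simp
        _ ≤ (m * (μk (φ k) / r ^ μk (φ k))) *
            (f zstar + 1 / (μk (φ k) : ℝ) - f (zk (φ k))) := by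
          refine mul_le_mul_of_nonneg_left (le_trans ?_ (hpen k)) (by positivity)
          exact mul_le_mul_of_nonneg_left hpow (by positivity)
    linarith
  have hbox : zhat ∈ {z : Fin m → ℝ | ∀ i, -1 ≤ z i ∧ z i ≤ 1} :=
    fun i => abs_le.mp (hmem i)
  refine ⟨hbox, le_antisymm ?_ (hzstar_min zhat hbox)⟩
  have hnonneg : 0 ≤ f zstar + 0 - f zhat := by
    refine ge_of_tendsto' hgap fun k => le_trans ?_ (hpen k)
    exact mul_nonneg (by positivity)
      (Finset.sum_nonneg fun j _ => (hμ_even (φ k)).pow_nonneg _)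
  linarith
end

section
/- Geometric penalty growth yields a geometric error bound: with μ_n = τ^n · μ_0, if z^n is a global minimizer over ℝ^m of P(·; μ_n) and additionally z^n ∈ Ω, then |f(z^n) − f(z*)| ≤ 2/(τ^n · μ_0). (Inequality (30) in the proof of Theorem 2.) -/
/-- Inequality (30) in the proof of Theorem 2: with `μₙ = τⁿ μ₀`, a feasible global
minimizer `zⁿ` of the monomial barrier function satisfies
`|f(zⁿ) − f(z*)| ≤ 2/(τⁿ μ₀)`. -/
theorem monomial_barrier_geometric_error_bound
    (m : ℕ) (hm : 1 ≤ m) (f : (Fin m → ℝ) → ℝ)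
    (hconv : ConvexOn ℝ Set.univ f) (hcont : Continuous f)
    (Ω : Set (Fin m → ℝ)) (hΩ : Ω = {z | ∀ i, -1 ≤ z i ∧ z i ≤ 1})
    (zstar : Fin m → ℝ) (hzstar_mem : zstar ∈ Ω)
    (hzstar_min : ∀ z ∈ Ω, f zstar ≤ f z)
    (μ0 τ n : ℕ) (hμ0_even : Even μ0) (hμ0_pos : 0 < μ0) (hτ : 1 < τ)
    (μn : ℕ) (hμn : μn = τ ^ n * μ0)
    (zn : Fin m → ℝ)
    (hzn_min : ∀ y : Fin m → ℝ,
      f zn + (1 / ((m : ℝ) * (μn : ℝ))) * ∑ i, (zn i) ^ μn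
        ≤ f y + (1 / ((m : ℝ) * (μn : ℝ))) * ∑ i, (y i) ^ μn)
    (hzn_feas : zn ∈ Ω) :
    |f zn - f zstar| ≤ 2 / ((τ : ℝ) ^ n * (μ0 : ℝ)) := by
  subst hΩ
  have heven : Even μn := hμn ▸ hμ0_even.mul_left _
  have hm_pos : (0 : ℝ) < m := by exact_mod_cast hm
  have hcast : (μn : ℝ) = (τ : ℝ) ^ n * (μ0 : ℝ) := by rw [hμn]; push_cast; rfl
  have hμn_pos : (0 : ℝ) < μn := by
    have : 0 < μn := hμn ▸ Nat.mul_pos (pow_pos (by omega) n) hμ0_pos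
    exact_mod_cast this
  have hc : 0 ≤ 1 / ((m : ℝ) * (μn : ℝ)) := by positivity
  have hsum_nonneg : 0 ≤ ∑ i, (zn i) ^ μn := Finset.sum_nonneg fun i _ => heven.pow_nonneg _
  have hsum_le : ∑ i, (zstar i) ^ μn ≤ (m : ℝ) := by
    calc ∑ i, (zstar i) ^ μn ≤ ∑ _i : Fin m, (1 : ℝ) := by
          refine Finset.sum_le_sum fun i _ => ?_
          rw [← heven.pow_abs]
          exact pow_le_one₀ (abs_nonneg _) (abs_le.mpr (hzstar_mem i))
      _ = m := by simp
  have hpenalty : 1 / ((m : ℝ) * (μn : ℝ)) * ∑ i, (zstar i) ^ μn ≤ 1 / μn :=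
    calc 1 / ((m : ℝ) * (μn : ℝ)) * ∑ i, (zstar i) ^ μn
        ≤ 1 / ((m : ℝ) * (μn : ℝ)) * m := mul_le_mul_of_nonneg_left hsum_le hc
      _ = 1 / μn := by field_simp
  have hone_le_two : 1 / (μn : ℝ) ≤ 2 / μn := by gcongr; norm_num
  rw [← hcast, abs_of_nonneg (sub_nonneg.mpr (hzstar_min zn hzn_feas))]
  linarith [hzn_min zstar, mul_nonneg hc hsum_nonneg]
end

section
/- Exterior/boundary case of Example 1: if a ≥ 1 and for each even integer μ ≥ 2, x_μ denotes the unique global minimizer of P(x) = (1/2)(x − a)² + x^μ/μ, then x_μ → 1 as μ → ∞ along even integers; i.e. the barrier minimizers converge to the minimizer 1 of (1/2)(x − a)² over [−1, 1]. -/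
/-- Exterior/boundary case of Example 1: if `a ≥ 1` and `x μ` is the global minimizer
of `(1/2)(x − a)² + x^μ/μ` for each even `μ ≥ 2`, then `x μ → 1` as `μ → ∞` along
even integers. -/
theorem one_dim_monomial_barrier_exterior_limit
    (a : ℝ) (ha : 1 ≤ a) (x : ℕ → ℝ)
    (hx : ∀ μ : ℕ, Even μ → 2 ≤ μ → ∀ y : ℝ,
      (1 / 2) * (x μ - a) ^ 2 + (x μ) ^ μ / (μ : ℝ)
        ≤ (1 / 2) * (y - a) ^ 2 + y ^ μ / (μ : ℝ)) :
    Filter.Tendsto x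
      (Filter.atTop ⊓ Filter.principal {μ : ℕ | Even μ ∧ 2 ≤ μ}) (nhds 1) := by
  rw [Metric.tendsto_nhds]
  intro ε hε
  rw [Filter.eventually_inf_principal]
  have hlow : ∀ᶠ μ : ℕ in Filter.atTop, 2 / (μ : ℝ) < ε ^ 2 :=
    (tendsto_const_div_atTop_nhds_zero_nat 2).eventually_lt_const (by positivity)
  have hC : 0 < (1 - a) ^ 2 / 2 + 1 := by positivity
  have hup : ∀ᶠ μ : ℕ in Filter.atTop,
      (μ : ℝ) ^ 1 / (1 + ε) ^ μ < 1 / ((1 - a) ^ 2 / 2 + 1) :=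
    (tendsto_pow_const_div_const_pow_of_one_lt 1 (by linarith)).eventually_lt_const
      (by positivity)
  filter_upwards [hlow, hup] with μ hμlow hμup ⟨heven, htwo⟩
  have hμ : (1 : ℝ) ≤ μ := by exact_mod_cast (by omega : 1 ≤ μ)
  have hmin := hx μ heven htwo 1
  rw [one_pow] at hmin
  rw [Real.dist_eq, abs_lt]
  constructor
  · by_contra! h
    have hpow : 0 ≤ (x μ) ^ μ / (μ : ℝ) := div_nonneg (heven.pow_nonneg _) (by linarith)
    have htwice : 2 / (μ : ℝ) = 2 * (1 / μ) := by ring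
    have hsq : (a - 1 + ε) ^ 2 ≤ (a - x μ) ^ 2 :=
      pow_le_pow_left₀ (by linarith) (by linarith) 2
    nlinarith [mul_nonneg (sub_nonneg.2 ha) hε.le]
  · by_contra! h
    have hpow : (1 + ε) ^ μ ≤ (x μ) ^ μ :=
      pow_le_pow_left₀ (by linarith) (by linarith) μ
    rw [pow_one, div_lt_div_iff₀ (by positivity) hC, one_mul] at hμup
    have hlarge : (1 - a) ^ 2 / 2 + 1 < (x μ) ^ μ / (μ : ℝ) := by
      rw [lt_div_iff₀ (by linarith)]
      linarith
    have hinv : 1 / (μ : ℝ) ≤ 1 := by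
      rw [div_le_one (by linarith)]
      exact hμ
    linarith [sq_nonneg (x μ - a)]
end

section
/- Projected-gradient optimality criterion: let f : ℝ^m → ℝ be convex and differentiable, let l, u ∈ ℝ^m with l ≤ u componentwise, and let x ∈ [l, u]. Then x is a global minimizer of f over {y : l ≤ y ≤ u} if and only if proj(x_i − ∂f/∂x_i(x), l_i, u_i) = x_i for every index i, i.e. the projection of x − ∇f(x) onto the box equals x. (The stopping criterion (eq_gr) of the algorithm characterizes optimality.) -/
/-- The scalar projection onto the interval `[l, u]`. -/
noncomputable def proj (t l u : ℝ) : ℝ :=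
  if t < l then l else if t ≤ u then t else u

/-- On an interval, a fixed point of the projected gradient step is a point satisfying the
variational inequality. -/
lemma proj_sub_eq_self_iff {x g l u : ℝ} (hl : l ≤ x) (hu : x ≤ u) :
    proj (x - g) l u = x ↔ ∀ s, l ≤ s → s ≤ u → 0 ≤ g * (s - x) := by
  constructor
  · intro h s hs hs'
    unfold proj at h
    split_ifs at h with h₁ h₂
    · exact mul_nonneg (by linarith) (by linarith)
    · simp [show g = 0 by linarith]
    · exact mul_nonneg_of_nonpos_of_nonpos (by linarith) (by linarith)
  · intro h
    have hgl := h l le_rfl (hl.trans hu)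
    have hgu := h u (hl.trans hu) le_rfl
    unfold proj
    split_ifs with h₁ h₂
    · nlinarith
    · rcases lt_trichotomy g 0 with hg | hg | hg <;> nlinarith
    · nlinarith

/-- The first-order lower bound of a convex function at a point of differentiability. -/
lemma ConvexOn.add_fderiv_le {E : Type*} [NormedAddCommGroup E] [NormedSpace ℝ E]
    {s : Set E} {f : E → ℝ} {f' : E →L[ℝ] ℝ} {x y : E} (hf : ConvexOn ℝ s f)
    (hx : x ∈ s) (hy : y ∈ s) (hf' : HasFDerivAt f f' x) :
    f x + f' (y - x) ≤ f y := by
  have hconv := hf.comp_affineMap (AffineMap.lineMap x y)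
  have hderiv : HasDerivAt (f ∘ AffineMap.lineMap x y) (f' (y - x)) (0 : ℝ) :=
    HasFDerivAt.comp_hasDerivAt (0 : ℝ) (by simpa using hf') AffineMap.hasDerivAt_lineMap
  have h := hconv.le_slope_of_hasDerivAt (x := 0) (y := 1) (by simpa using hx)
    (by simpa using hy) one_pos hderiv
  simp only [slope_def_field, Function.comp_apply, AffineMap.lineMap_apply_zero,
    AffineMap.lineMap_apply_one, sub_zero, div_one] at h
  linarith

/-- A differentiable convex function is minimized over a convex set exactly at the solutions of
the variational inequality of its derivative. -/
lemma ConvexOn.isMinOn_iff_fderiv_nonneg {E : Type*} [NormedAddCommGroup E] [NormedSpace ℝ E]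
    {s : Set E} {f : E → ℝ} {f' : E →L[ℝ] ℝ} {x : E} (hf : ConvexOn ℝ s f)
    (hx : x ∈ s) (hf' : HasFDerivAt f f' x) :
    IsMinOn f s x ↔ ∀ y ∈ s, 0 ≤ f' (y - x) := by
  refine ⟨fun h y hy => ?_, fun h y hy => ?_⟩
  · exact h.localize.hasFDerivWithinAt_nonneg hf'.hasFDerivWithinAt
      (sub_mem_posTangentConeAt_of_segment_subset (hf.1.segment_subset hx hy))
  · have := hf.add_fderiv_le hx hy hf'
    have := h y hy
    change f x ≤ f y
    linarith

/-- A variational inequality over a box decouples into one inequality per coordinate. -/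
lemma forall_mem_Icc_clm_sub_nonneg_iff {ι : Type*} [Fintype ι] [DecidableEq ι]
    {l u x : ι → ℝ} (hx : x ∈ Set.Icc l u) (φ : (ι → ℝ) →L[ℝ] ℝ) :
    (∀ y ∈ Set.Icc l u, 0 ≤ φ (y - x)) ↔
      ∀ i s, l i ≤ s → s ≤ u i → 0 ≤ φ (Pi.single i 1) * (s - x i) := by
  constructor
  · intro h i s hl hu
    have hy : Function.update x i s ∈ Set.Icc l u :=
      ⟨le_update_iff.2 ⟨hl, fun j _ => hx.1 j⟩, update_le_iff.2 ⟨hu, fun j _ => hx.2 j⟩⟩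
    have hsub : Function.update x i s - x = (s - x i) • Pi.single i (1 : ℝ) := by
      ext j
      rcases eq_or_ne j i with rfl | hj <;> simp [*]
    simpa [hsub, mul_comm] using h _ hy
  · intro h y hy
    rw [pi_eq_sum_univ' (y - x), map_sum]
    refine Finset.sum_nonneg fun i _ => ?_
    have := h i (y i) (hy.1 i) (hy.2 i)
    rw [map_smul, smul_eq_mul, mul_comm]
    convert this using 3
    · ext j
      simp
    · rfl

/-- Projected-gradient optimality criterion (stopping criterion (eq_gr)): a point `x`
of the box `[l, u]` is a global minimizer of the convex differentiable `f` over the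
box iff the componentwise projection of `x − ∇f(x)` onto the box equals `x`. -/
theorem projected_gradient_optimality
    (m : ℕ) (f : (Fin m → ℝ) → ℝ)
    (hconv : ConvexOn ℝ Set.univ f) (hdiff : Differentiable ℝ f)
    (l u : Fin m → ℝ) (hlu : ∀ i, l i ≤ u i)
    (x : Fin m → ℝ) (hx : ∀ i, l i ≤ x i ∧ x i ≤ u i) :
    (∀ y : Fin m → ℝ, (∀ i, l i ≤ y i ∧ y i ≤ u i) → f x ≤ f y) ↔
    (∀ i, proj (x i - fderiv ℝ f x (Pi.single i 1)) (l i) (u i) = x i) := by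
  have hmem : ∀ y, y ∈ Set.Icc l u ↔ ∀ i, l i ≤ y i ∧ y i ≤ u i := fun y =>
    forall_and.symm
  have hxm := (hmem x).2 hx
  have hbox := (hconv.subset (Set.subset_univ _) (convex_Icc l u)).isMinOn_iff_fderiv_nonneg hxm
    (hdiff x).hasFDerivAt
  simp_rw [← hmem, proj_sub_eq_self_iff (hx _).1 (hx _).2]
  rw [← forall_mem_Icc_clm_sub_nonneg_iff hxm, ← hbox, isMinOn_iff]
end
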